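/- Let n ≥ 2 be an integer and α > 0 a real number. If x ∈ ℝⁿ satisfies x_i ≥ 0 for all i and Σ_{i∈D} x_i ≤ α√|D| for every subset D ⊆ {1, …, n}, then Σ_{i=1}^n x_i² ≤ ((ln n + 5)/4) · α². -/

import Mathlib

/-- Summation by parts: nonnegative partial sums stay nonnegative under antitone weights. -/
lemma mul_sum_range_le_sum_range_mul {n : ℕ} {w c : ℕ → ℝ} (hw : Antitone w)
    (hc : ∀ k ≤ n, 0 ≤ ∑ i ∈ Finset.range k, c i) :
    w n * ∑ i ∈ Finset.range n, c i ≤ ∑ i ∈ Finset.range n, w i * c i := by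
  induction n with
  | zero => simp
  | succ m ih =>
    have h := ih fun k hk => hc k (by omega)
    have hmul := mul_le_mul_of_nonneg_right (hw m.le_succ) (hc (m + 1) le_rfl)
    rw [Finset.sum_range_succ] at hmul ⊢
    rw [Finset.sum_range_succ]
    linarith

lemma sum_range_mul_le_of_sum_range_le {n : ℕ} {w a b : ℕ → ℝ} (hw : Antitone w)
    (hw0 : 0 ≤ w n)
    (hab : ∀ k ≤ n, ∑ i ∈ Finset.range k, a i ≤ ∑ i ∈ Finset.range k, b i) :
    ∑ i ∈ Finset.range n, w i * a i ≤ ∑ i ∈ Finset.range n, w i * b i := by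
  have hc : ∀ k ≤ n, 0 ≤ ∑ i ∈ Finset.range k, (b i - a i) := fun k hk => by
    rw [Finset.sum_sub_distrib]
    linarith [hab k hk]
  have h := mul_sum_range_le_sum_range_mul hw hc
  have h0 := mul_nonneg hw0 (hc n le_rfl)
  simp only [mul_sub, Finset.sum_sub_distrib] at h h0
  linarith

lemma antitone_sqrt_succ_sub_sqrt :
    Antitone fun k : ℕ => Real.sqrt (k + 1) - Real.sqrt k := by
  refine antitone_nat_of_succ_le fun k => ?_
  have h0 := Real.sq_sqrt (show (0 : ℝ) ≤ k by positivity)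
  have h1 := Real.sq_sqrt (show (0 : ℝ) ≤ k + 1 by positivity)
  have h2 := Real.sq_sqrt (show (0 : ℝ) ≤ k + 1 + 1 by positivity)
  have p0 := Real.sqrt_nonneg (k : ℝ)
  have p1 := Real.sqrt_nonneg ((k : ℝ) + 1)
  have p2 := Real.sqrt_nonneg ((k : ℝ) + 1 + 1)
  push_cast
  nlinarith [sq_nonneg (Real.sqrt ((k : ℝ) + 1 + 1) - Real.sqrt k)]

lemma sq_sqrt_succ_sub_sqrt_le {t : ℝ} (ht : 0 < t) :
    (Real.sqrt (t + 1) - Real.sqrt t) ^ 2 ≤ 1 / (4 * t) := by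
  have h0 := Real.sq_sqrt ht.le
  have h1 := Real.sq_sqrt (show (0 : ℝ) ≤ t + 1 by positivity)
  have p0 := Real.sqrt_pos.2 ht
  have hle : Real.sqrt t ≤ Real.sqrt (t + 1) := Real.sqrt_le_sqrt (by linarith)
  have hprod : (Real.sqrt (t + 1) - Real.sqrt t) * (Real.sqrt (t + 1) + Real.sqrt t) = 1 := by
    linarith [sq_sub_sq (Real.sqrt (t + 1)) (Real.sqrt t)]
  have hmul : (Real.sqrt (t + 1) - Real.sqrt t) * (2 * Real.sqrt t) ≤ 1 := by nlinarith
  have hnn : 0 ≤ (Real.sqrt (t + 1) - Real.sqrt t) * (2 * Real.sqrt t) :=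
    mul_nonneg (by linarith) (by linarith)
  rw [le_div_iff₀ (by positivity)]
  calc (Real.sqrt (t + 1) - Real.sqrt t) ^ 2 * (4 * t)
      = ((Real.sqrt (t + 1) - Real.sqrt t) * (2 * Real.sqrt t)) ^ 2 := by
        rw [mul_pow, mul_pow _ (Real.sqrt t), h0]; ring
    _ ≤ 1 := pow_le_one₀ hnn hmul

lemma sum_sq_sqrt_succ_sub_sqrt_le {n : ℕ} (hn : 1 ≤ n) :
    ∑ k ∈ Finset.range n, (Real.sqrt (k + 1) - Real.sqrt k) ^ 2
      ≤ (Real.log n + 5 - 1 / n) / 4 := by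
  induction n, hn using Nat.le_induction with
  | base => norm_num
  | succ m hm ih =>
    have hm0 : (0 : ℝ) < m := by exact_mod_cast hm
    have hsq := sq_sqrt_succ_sub_sqrt_le hm0
    have hlog := Real.one_sub_inv_le_log_of_pos (show (0 : ℝ) < (m + 1) / m by positivity)
    rw [Real.log_div (by positivity) hm0.ne'] at hlog
    have hinv : 1 - (((m : ℝ) + 1) / m)⁻¹ = 1 / (m + 1) := by field_simp; ring
    have hquarter : 1 / (4 * (m : ℝ)) = 1 / m / 4 := by field_simp
    rw [Finset.sum_range_succ]
    push_cast
    linarith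

/-- Extension by zero of the decreasing rearrangement of a nonnegative vector. -/
lemma exists_antitone_rearrangement {n : ℕ} {x : Fin n → ℝ} (hpos : ∀ i, 0 ≤ x i) :
    ∃ (σ : Equiv.Perm (Fin n)) (y : ℕ → ℝ),
      Antitone y ∧ (∀ k, 0 ≤ y k) ∧ ∀ i : Fin n, y i = x (σ i) := by
  let σ := Tuple.sort fun i => -x i
  have hσ : Monotone ((fun i => -x i) ∘ σ) := Tuple.monotone_sort _
  refine ⟨σ, fun k => if h : k < n then x (σ ⟨k, h⟩) else 0, fun a b hab => ?_, fun k => ?_,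
    fun i => by simp⟩
  · by_cases hb : b < n
    · have ha : a < n := hab.trans_lt hb
      simpa [ha, hb] using hσ (show (⟨a, ha⟩ : Fin n) ≤ ⟨b, hb⟩ from hab)
    · by_cases ha : a < n <;> simp [ha, hb, hpos]
  · by_cases hk : k < n <;> simp [hk, hpos]

/-- Let `n ≥ 2` and `α > 0`. If `x ∈ ℝⁿ` has nonnegative entries and
`Σ_{i∈D} x_i ≤ α√|D|` for every subset `D ⊆ {1,…,n}`, then
`Σ_{i=1}^n x_i² ≤ ((ln n + 5)/4) · α²`. -/
theorem stmt3 (n : ℕ) (hn : 2 ≤ n) (α : ℝ) (hα : 0 < α) (x : Fin n → ℝ)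
    (hpos : ∀ i, 0 ≤ x i)
    (hcon : ∀ D : Finset (Fin n), ∑ i ∈ D, x i ≤ α * Real.sqrt D.card) :
    ∑ i, (x i) ^ 2 ≤ (Real.log n + 5) / 4 * α ^ 2 := by
  obtain ⟨σ, y, hy, hy0, hyx⟩ := exists_antitone_rearrangement hpos
  let d : ℕ → ℝ := fun k => α * (Real.sqrt (k + 1) - Real.sqrt k)
  have hd : Antitone d := fun a b hab =>
    mul_le_mul_of_nonneg_left (antitone_sqrt_succ_sub_sqrt hab) hα.le
  have hd0 : 0 ≤ d n :=
    mul_nonneg hα.le (sub_nonneg.2 (Real.sqrt_le_sqrt (by linarith)))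
  have hdsum (k : ℕ) : ∑ i ∈ Finset.range k, d i = α * Real.sqrt k := by
    have h := Finset.sum_range_sub (fun i : ℕ => Real.sqrt i) k
    push_cast at h
    rw [← Finset.mul_sum, h, Real.sqrt_zero, sub_zero]
  have hprefix : ∀ k ≤ n, ∑ i ∈ Finset.range k, y i ≤ ∑ i ∈ Finset.range k, d i := by
    intro k hk
    have h := hcon (Finset.univ.map ((Fin.castLEEmb hk).trans σ.toEmbedding))
    rw [hdsum, ← Fin.sum_univ_eq_sum_range]
    simp only [Finset.sum_map, Finset.card_map, Finset.card_univ, Fintype.card_fin] at h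
    refine le_trans (Finset.sum_le_sum fun i _ => ?_) h
    exact (hyx (Fin.castLE hk i)).le
  calc ∑ i, (x i) ^ 2 = ∑ i, (x (σ i)) ^ 2 := (Equiv.sum_comp σ fun i => (x i) ^ 2).symm
    _ = ∑ k ∈ Finset.range n, y k * y k := by
        rw [← Fin.sum_univ_eq_sum_range fun k => y k * y k]
        simp only [hyx, sq]
    _ ≤ ∑ k ∈ Finset.range n, y k * d k := sum_range_mul_le_of_sum_range_le hy (hy0 n) hprefix
    _ = ∑ k ∈ Finset.range n, d k * y k := by simp only [mul_comm]
    _ ≤ ∑ k ∈ Finset.range n, d k * d k := sum_range_mul_le_of_sum_range_le hd hd0 hprefix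
    _ = (∑ k ∈ Finset.range n, (Real.sqrt (k + 1) - Real.sqrt k) ^ 2) * α ^ 2 := by
        rw [Finset.sum_mul]
        exact Finset.sum_congr rfl fun k _ => by simp only [d]; ring
    _ ≤ (Real.log n + 5) / 4 * α ^ 2 := by
        have h := sum_sq_sqrt_succ_sub_sqrt_le (show 1 ≤ n by omega)
        have hn0 : (0 : ℝ) ≤ 1 / n := by positivity
        exact mul_le_mul_of_nonneg_right (by linarith) (sq_nonneg α)
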